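/- Let A1, A2, B1, B2 be pairwise disjoint finite sets with |A1| ≥ |B1| ≥ 1 and |A2| ≥ |B2| ≥ 1, and let G1, G2, G3 and w be as in the combined setup. Let M1 be an optimal MCM for BOT(G1) such that e1 = {a1, b1} ∈ M1 (with a1 ∈ A1, b1 ∈ B1) is a critical bottleneck edge of G1 relative to M1, e1 is the unique element of argmax_{e∈M1} w(e), and G1 is a bottleneck cluster relative to e1; let M2 be an optimal MCM for BOT(G2) such that e2 ∈ M2 is a critical bottleneck edge of G2 relative to M2 and G2 is a bottleneck cluster relative to e2; assume w(e1) > w(e2). Define V_ν := {b1} ∪ {v ∈ A1∪B1 : there is an alternating path P ⊆ φ(G1,M1)\{e1} relative to M1 between v and b1} and V_μ := (A1∪B1)\V_ν. If there do NOT exist an agent i ∈ A2 and a task j ∈ B2 simultaneously satisfying all three conditions — (i) there exists a task b' ∈ V_ν ∩ B1 with w({i, b'}) < w(e1); (ii) there exists an agent a' ∈ V_μ ∩ A1 with w({j, a'}) < w(e1); (iii) there exists an alternating path P relative to M2 between i and j all of whose edges have weight less than w(e1) with |P ∩ M2| > |P \ M2| — then M1 ∪ M2 is an optimal MCM for BOT(G3).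 -/

import Mathlib

/-- Edge set of the complete bipartite graph with parts `A` (agents) and `B` (tasks). -/
def bipEdges {V : Type*} [DecidableEq V] (A B : Finset V) : Finset (Sym2 V) :=
  (A ×ˢ B).image (fun p => s(p.1, p.2))

/-- `M` is a matching in the graph with edge set `E`: a set of edges of `E` such that
no vertex is incident with more than one edge of `M`. -/
def IsMatching {V : Type*} (E M : Finset (Sym2 V)) : Prop :=
  M ⊆ E ∧ ∀ v : V, ∀ e₁ ∈ M, ∀ e₂ ∈ M, v ∈ e₁ → v ∈ e₂ → e₁ = e₂

/-- `M` is a maximum cardinality matching of the graph with edge set `E`. -/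
def IsMCM {V : Type*} (E M : Finset (Sym2 V)) : Prop :=
  IsMatching E M ∧ ∀ M' : Finset (Sym2 V), IsMatching E M' → M'.card ≤ M.card

/-- `e` attains the maximum weight among the edges of `M`, i.e. `e ∈ argmax_{e' ∈ M} w e'`. -/
def IsMaxEdge {V : Type*} (w : Sym2 V → ℝ) (M : Finset (Sym2 V)) (e : Sym2 V) : Prop :=
  e ∈ M ∧ ∀ e' ∈ M, w e' ≤ w e

/-- `M` is an optimal solution to the bottleneck assignment problem `BOT` on the graph with
edge set `E`: it is an MCM whose maximum edge weight is no larger than that of any MCM. -/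
def IsOptMCM {V : Type*} (E : Finset (Sym2 V)) (w : Sym2 V → ℝ) (M : Finset (Sym2 V)) : Prop :=
  IsMCM E M ∧ ∀ M' e e', IsMCM E M' → IsMaxEdge w M e → IsMaxEdge w M' e' → w e ≤ w e'

/-- `e` is a bottleneck edge: it attains the maximum weight in some optimal MCM. -/
def IsBottleneckEdge {V : Type*} (E : Finset (Sym2 V)) (w : Sym2 V → ℝ) (e : Sym2 V) : Prop :=
  ∃ M, IsOptMCM E w M ∧ IsMaxEdge w M e

/-- `P` is a path between `u` and `v` whose edges all lie in `E`: it is the set of consecutive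
edges of a sequence of distinct vertices `u = v₁, v₂, …, v_{l+1} = v` (with `l ≥ 1`). -/
def IsPath {V : Type*} [DecidableEq V] (E P : Finset (Sym2 V)) (u v : V) : Prop :=
  ∃ l : List V, l.Nodup ∧ 2 ≤ l.length ∧ l.head? = some u ∧ l.getLast? = some v ∧
    (∀ e ∈ List.zipWith (fun a b => s(a, b)) l l.tail, e ∈ E) ∧
    P = (List.zipWith (fun a b => s(a, b)) l l.tail).toFinset

/-- The alternation condition: every vertex is incident with at most one edge of `P ∩ M`
and at most one edge of `P \ M`. -/
def AltCond {V : Type*} [DecidableEq V] (M P : Finset (Sym2 V)) : Prop :=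
  (∀ x : V, ∀ e₁ ∈ P ∩ M, ∀ e₂ ∈ P ∩ M, x ∈ e₁ → x ∈ e₂ → e₁ = e₂) ∧
  (∀ x : V, ∀ e₁ ∈ P \ M, ∀ e₂ ∈ P \ M, x ∈ e₁ → x ∈ e₂ → e₁ = e₂)

/-- `P` is an alternating path relative to the matching `M`, between `u` and `v`, with all
edges in `E`. -/
def IsAltPath {V : Type*} [DecidableEq V] (E M P : Finset (Sym2 V)) (u v : V) : Prop :=
  IsPath E P u v ∧ AltCond M P

/-- `v` is a free vertex relative to the matching `M`. -/
def IsFree {V : Type*} (M : Finset (Sym2 V)) (v : V) : Prop :=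
  ∀ e ∈ M, v ∉ e

/-- `P` is an augmenting path relative to the matching `M`, between the free vertices `u`
and `v`, with all edges in `E`. -/
def IsAugPath {V : Type*} [DecidableEq V] (E M P : Finset (Sym2 V)) (u v : V) : Prop :=
  IsAltPath E M P u v ∧ IsFree M u ∧ IsFree M v

open Classical in
/-- `φ(G, M)`: the union of `M` with the set of edges of `E` of weight strictly smaller than
the largest weight of an edge of `M`. -/
noncomputable def phi {V : Type*} [DecidableEq V] (E : Finset (Sym2 V)) (w : Sym2 V → ℝ)
    (M : Finset (Sym2 V)) : Finset (Sym2 V) :=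
  M ∪ E.filter (fun e => ∃ e', IsMaxEdge w M e' ∧ w e < w e')

/-- `e` is a critical bottleneck edge of the graph with edge set `E` relative to the matching
`M`: it attains the maximum weight in `M` and `φ(G,M) \ {e}` contains no augmenting path
relative to `M \ {e}`. -/
def IsCritBotEdge {V : Type*} [DecidableEq V] (E : Finset (Sym2 V)) (w : Sym2 V → ℝ)
    (M : Finset (Sym2 V)) (e : Sym2 V) : Prop :=
  IsMaxEdge w M e ∧ ¬ ∃ P u v, IsAugPath (phi E w M \ {e}) (M \ {e}) P u v

/-- The complete bipartite graph on parts `A`, `B` is a bottleneck cluster relative to a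
bottleneck edge with task endpoint `b`, for the optimal MCM `Mb`: every vertex is connected
to `b` by an alternating path contained in `φ(G, Mb)` relative to `Mb`. -/
def IsBotCluster {V : Type*} [DecidableEq V] (A B : Finset V) (w : Sym2 V → ℝ)
    (Mb : Finset (Sym2 V)) (b : V) : Prop :=
  ∀ v ∈ A ∪ B, v ≠ b → ∃ P, IsAltPath (phi (bipEdges A B) w Mb) Mb P v b

/-- The graph with vertex set `Vs` and edge set `Es` is a tree: edges join vertices of `Vs`
and there is a unique path between any two distinct vertices. -/
def IsTreeOn {V : Type*} [DecidableEq V] (Vs : Finset V) (Es : Finset (Sym2 V)) : Prop :=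
  (∀ e ∈ Es, ∀ x ∈ e, x ∈ Vs) ∧
  ∀ u ∈ Vs, ∀ v ∈ Vs, u ≠ v → ∃! P, IsPath Es P u v

/-- The graph `(Vs, Es)` is an alternating tree relative to the matching `M`, rooted at `r`:
it is a tree and every path from the root `r` to another vertex is an alternating path
relative to `M`. -/
def IsAltTree {V : Type*} [DecidableEq V] (M : Finset (Sym2 V)) (r : V) (Vs : Finset V)
    (Es : Finset (Sym2 V)) : Prop :=
  r ∈ Vs ∧ IsTreeOn Vs Es ∧ ∀ v ∈ Vs, ∀ P, IsPath Es P r v → AltCond M P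

/-- The vertex set `V_ν` associated with the bottleneck cluster `G1` relative to the critical
bottleneck edge `e1 = {a1, b1}`: the bottleneck task `b1` together with all vertices of `G1`
connected to `b1` by an alternating path `P ⊆ φ(G1, M1) \ {e1}` relative to `M1`. -/
def Vnu {V : Type*} [DecidableEq V] (A1 B1 : Finset V) (w : Sym2 V → ℝ)
    (M1 : Finset (Sym2 V)) (a1 b1 : V) : Set V :=
  insert b1 {v | v ∈ A1 ∪ B1 ∧
    ∃ P, IsAltPath (phi (bipEdges A1 B1) w M1 \ {s(a1, b1)}) M1 P v b1}

/-- The complementary vertex set `V_μ := (A1 ∪ B1) \ V_ν`. -/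
def Vmu {V : Type*} [DecidableEq V] (A1 B1 : Finset V) (w : Sym2 V → ℝ)
    (M1 : Finset (Sym2 V)) (a1 b1 : V) : Set V :=
  (↑(A1 ∪ B1) : Set V) \ Vnu A1 B1 w M1 a1 b1

section Matchings

variable {V : Type*}

/-- A matching each of whose edges meets `T` has at most `#T` edges. -/
theorem IsMatching.card_le_of_cover {E M : Finset (Sym2 V)} (hM : IsMatching E M) {T : Finset V}
    (hT : ∀ e ∈ M, ∃ v ∈ T, v ∈ e) : M.card ≤ T.card :=
  Finset.card_le_card_of_forall_subsingleton (fun e v => v ∈ e)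
    (fun e he => hT e he)
    (fun v _ e₁ h₁ e₂ h₂ => hM.2 v e₁ h₁.1 e₂ h₂.1 h₁.2 h₂.2)

theorem IsMatching.eq_left {E M : Finset (Sym2 V)} (hM : IsMatching E M) {a a' b : V}
    (h : s(a, b) ∈ M) (h' : s(a', b) ∈ M) : a = a' :=
  Sym2.congr_left.1
    (hM.2 b _ h _ h' (Sym2.mem_mk_right _ _) (Sym2.mem_mk_right _ _))

theorem IsMatching.eq_right {E M : Finset (Sym2 V)} (hM : IsMatching E M) {a b b' : V}
    (h : s(a, b) ∈ M) (h' : s(a, b') ∈ M) : b = b' :=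
  Sym2.congr_right.1
    (hM.2 a _ h _ h' (Sym2.mem_mk_left _ _) (Sym2.mem_mk_left _ _))

variable [DecidableEq V]

theorem mem_bipEdges {A B : Finset V} {e : Sym2 V} :
    e ∈ bipEdges A B ↔ ∃ a ∈ A, ∃ b ∈ B, s(a, b) = e := by
  simp only [bipEdges, Finset.mem_image, Finset.mem_product, Prod.exists]
  constructor
  · rintro ⟨a, b, ⟨ha, hb⟩, h⟩
    exact ⟨a, ha, b, hb, h⟩
  · rintro ⟨a, ha, b, hb, h⟩
    exact ⟨a, b, ⟨ha, hb⟩, h⟩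

theorem mk_mem_bipEdges {A B : Finset V} {x y : V} :
    s(x, y) ∈ bipEdges A B ↔ (x ∈ A ∧ y ∈ B) ∨ (y ∈ A ∧ x ∈ B) := by
  rw [mem_bipEdges]
  constructor
  · rintro ⟨a, ha, b, hb, h⟩
    rcases Sym2.eq_iff.1 h with ⟨rfl, rfl⟩ | ⟨rfl, rfl⟩
    · exact Or.inl ⟨ha, hb⟩
    · exact Or.inr ⟨ha, hb⟩
  · rintro (⟨h1, h2⟩ | ⟨h1, h2⟩)
    · exact ⟨x, h1, y, h2, rfl⟩
    · exact ⟨y, h1, x, h2, Sym2.eq_swap⟩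

theorem bipEdges_mono {A A' B B' : Finset V} (hA : A ⊆ A') (hB : B ⊆ B') :
    bipEdges A B ⊆ bipEdges A' B' :=
  Finset.image_subset_image (Finset.product_subset_product hA hB)

theorem IsMatching.card_le {A B : Finset V} {M : Finset (Sym2 V)}
    (hM : IsMatching (bipEdges A B) M) : M.card ≤ B.card := by
  refine hM.card_le_of_cover fun e he => ?_
  obtain ⟨a, -, b, hb, rfl⟩ := mem_bipEdges.1 (hM.1 he)
  exact ⟨b, hb, Sym2.mem_mk_right a b⟩

/-- A matching with at least `#B` edges covers every vertex of `B`. -/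
theorem IsMatching.exists_mate {A B : Finset V} {M : Finset (Sym2 V)}
    (hM : IsMatching (bipEdges A B) M) (hcard : B.card ≤ M.card)
    {b : V} (hb : b ∈ B) : ∃ a ∈ A, s(a, b) ∈ M := by
  by_contra! hno
  have h : M.card ≤ (B.erase b).card := by
    refine hM.card_le_of_cover fun e he => ?_
    obtain ⟨a, ha, c, hc, rfl⟩ := mem_bipEdges.1 (hM.1 he)
    refine ⟨c, Finset.mem_erase.2 ⟨?_, hc⟩, Sym2.mem_mk_right a c⟩
    rintro rfl
    exact hno a ha he
  have := Finset.card_erase_lt_of_mem hb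
  omega

theorem exists_isMatching_card {A B : Finset V} (hAB : Disjoint A B) (h : B.card ≤ A.card) :
    ∃ M, IsMatching (bipEdges A B) M ∧ M.card = B.card := by
  obtain ⟨f⟩ : Nonempty (B ↪ A) := Function.Embedding.nonempty_of_card_le (by simpa using h)
  have hne : ∀ (a : A) (b : B), (a : V) ≠ b := fun a b hab =>
    Finset.disjoint_left.1 hAB a.2 (hab ▸ b.2)
  refine ⟨B.attach.image fun b => s((f b : V), (b : V)), ⟨?_, ?_⟩, ?_⟩
  · intro e he
    obtain ⟨b, -, rfl⟩ := Finset.mem_image.1 he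
    exact mk_mem_bipEdges.2 (Or.inl ⟨(f b).2, b.2⟩)
  · intro v e₁ h₁ e₂ h₂ hv₁ hv₂
    obtain ⟨b, -, rfl⟩ := Finset.mem_image.1 h₁
    obtain ⟨c, -, rfl⟩ := Finset.mem_image.1 h₂
    have hbc : b = c := by
      rcases Sym2.mem_iff.1 hv₁ with h | h <;> rcases Sym2.mem_iff.1 hv₂ with h' | h'
      · exact f.injective (Subtype.ext (h.symm.trans h'))
      · exact absurd (h.symm.trans h') (hne _ _)
      · exact absurd (h'.symm.trans h) (hne _ _)
      · exact Subtype.ext (h.symm.trans h')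
    rw [hbc]
  · rw [Finset.card_image_of_injective, Finset.card_attach]
    intro b c hbc
    rcases Sym2.eq_iff.1 hbc with ⟨-, h⟩ | ⟨h, -⟩
    · exact Subtype.ext h
    · exact absurd h (hne _ _)

theorem IsMCM.card_eq {A B : Finset V} {M : Finset (Sym2 V)} (hM : IsMCM (bipEdges A B) M)
    (hAB : Disjoint A B) (h : B.card ≤ A.card) : M.card = B.card := by
  obtain ⟨N, hN, hcard⟩ := exists_isMatching_card hAB h
  exact le_antisymm hM.1.card_le (hcard ▸ hM.2 N hN)

theorem IsMatching.union {A₁ A₂ B₁ B₂ : Finset V} {M₁ M₂ : Finset (Sym2 V)}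
    (h₁ : IsMatching (bipEdges A₁ B₁) M₁) (h₂ : IsMatching (bipEdges A₂ B₂) M₂)
    (hd : Disjoint (A₁ ∪ B₁) (A₂ ∪ B₂)) :
    IsMatching (bipEdges (A₁ ∪ A₂) (B₁ ∪ B₂)) (M₁ ∪ M₂) ∧ Disjoint M₁ M₂ := by
  have mem : ∀ {A B : Finset V} {M}, IsMatching (bipEdges A B) M →
      ∀ {e}, e ∈ M → ∀ {v}, v ∈ e → v ∈ A ∪ B := by
    intro A B M hM e he v hv
    obtain ⟨a, ha, b, hb, rfl⟩ := mem_bipEdges.1 (hM.1 he)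
    rcases Sym2.mem_iff.1 hv with rfl | rfl
    · exact Finset.mem_union_left _ ha
    · exact Finset.mem_union_right _ hb
  have hne : ∀ {v e f}, e ∈ M₁ → f ∈ M₂ → v ∈ e → v ∈ f → False := fun he hf hve hvf =>
    Finset.disjoint_left.1 hd (mem h₁ he hve) (mem h₂ hf hvf)
  refine ⟨⟨Finset.union_subset
    (h₁.1.trans (bipEdges_mono Finset.subset_union_left Finset.subset_union_left))
    (h₂.1.trans (bipEdges_mono Finset.subset_union_right Finset.subset_union_right)), ?_⟩, ?_⟩
  · intro v e he f hf hve hvf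
    rcases Finset.mem_union.1 he with he | he <;> rcases Finset.mem_union.1 hf with hf | hf
    · exact h₁.2 v e he f hf hve hvf
    · exact (hne he hf hve hvf).elim
    · exact (hne hf he hvf hve).elim
    · exact h₂.2 v e he f hf hve hvf
  · refine Finset.disjoint_left.2 fun e he hf => ?_
    induction e with
    | _ x y => exact hne he hf (Sym2.mem_mk_left x y) (Sym2.mem_mk_left x y)

end Matchings

section AlternatingPaths

open Relation

variable {V : Type*}

/-- The list of edges joining consecutive vertices of `l`. -/
def pathEdges (l : List V) : List (Sym2 V) :=
  List.zipWith (fun a b => s(a, b)) l l.tail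

theorem pathEdges_cons_cons (x y : V) (t : List V) :
    pathEdges (x :: y :: t) = s(x, y) :: pathEdges (y :: t) := rfl

theorem mem_of_mem_pathEdges {l : List V} {e : Sym2 V} (he : e ∈ pathEdges l) {x : V}
    (hx : x ∈ e) : x ∈ l := by
  induction l with
  | nil => simp [pathEdges] at he
  | cons u t ih =>
    cases t with
    | nil => simp [pathEdges] at he
    | cons v t =>
      rw [pathEdges_cons_cons, List.mem_cons] at he
      rcases he with rfl | he
      · rcases Sym2.mem_iff.1 hx with rfl | rfl <;> simp
      · exact List.mem_cons_of_mem _ (ih he)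

theorem not_mem_pathEdges_of_nodup {x y : V} {t : List V} (h : (x :: y :: t).Nodup) :
    s(x, y) ∉ pathEdges (y :: t) := fun he =>
  (List.nodup_cons.1 h).1 (mem_of_mem_pathEdges he (Sym2.mem_mk_left x y))

/-- A step along an edge of `E` that lies in `M` exactly when it leaves the side `S`. -/
def AltStep (E M : Finset (Sym2 V)) (S : Finset V) (x y : V) : Prop :=
  s(x, y) ∈ E ∧ (s(x, y) ∈ M ↔ x ∈ S)

theorem mem_of_mem_pathEdges_of_isChain {E M : Finset (Sym2 V)} {S : Finset V} {l : List V}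
    (h : l.IsChain (AltStep E M S)) : ∀ e ∈ pathEdges l, e ∈ E := by
  induction l with
  | nil => simp [pathEdges]
  | cons x t ih =>
    cases t with
    | nil => simp [pathEdges]
    | cons y t =>
      rw [List.isChain_cons_cons] at h
      rw [pathEdges_cons_cons]
      intro e he
      rcases List.mem_cons.1 he with rfl | he
      · exact h.1.1
      · exact ih h.2 e he

variable [DecidableEq V]

theorem AltCond.mono {M P Q : Finset (Sym2 V)} (h : AltCond M Q) (hPQ : P ⊆ Q) : AltCond M P :=
  ⟨fun x e₁ h₁ e₂ h₂ => h.1 x e₁ (Finset.inter_subset_inter_right hPQ h₁) e₂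
      (Finset.inter_subset_inter_right hPQ h₂),
    fun x e₁ h₁ e₂ h₂ => h.2 x e₁ (Finset.sdiff_subset_sdiff hPQ le_rfl h₁) e₂
      (Finset.sdiff_subset_sdiff hPQ le_rfl h₂)⟩

theorem AltCond.insert {M P : Finset (Sym2 V)} (h : AltCond M P) {e : Sym2 V}
    (he : ∀ x ∈ e, ∀ f ∈ P, x ∈ f → ¬(e ∈ M ↔ f ∈ M)) : AltCond M (insert e P) := by
  obtain ⟨h1, h2⟩ := h
  simp only [Finset.mem_inter, Finset.mem_sdiff] at h1 h2
  constructor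
  · simp only [Finset.mem_inter, Finset.mem_insert]
    rintro x e₁ ⟨rfl | h₁, m₁⟩ e₂ ⟨rfl | h₂, m₂⟩ hx₁ hx₂
    · rfl
    · exact absurd (iff_of_true m₁ m₂) (he x hx₁ _ h₂ hx₂)
    · exact absurd (iff_of_true m₂ m₁) (he x hx₂ _ h₁ hx₁)
    · exact h1 x e₁ ⟨h₁, m₁⟩ e₂ ⟨h₂, m₂⟩ hx₁ hx₂
  · simp only [Finset.mem_sdiff, Finset.mem_insert]
    rintro x e₁ ⟨rfl | h₁, m₁⟩ e₂ ⟨rfl | h₂, m₂⟩ hx₁ hx₂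
    · rfl
    · exact absurd (iff_of_false m₁ m₂) (he x hx₁ _ h₂ hx₂)
    · exact absurd (iff_of_false m₂ m₁) (he x hx₂ _ h₁ hx₁)
    · exact h2 x e₁ ⟨h₁, m₁⟩ e₂ ⟨h₂, m₂⟩ hx₁ hx₂

theorem AltCond.sdiff_singleton {M P : Finset (Sym2 V)} (h : AltCond M P) {e : Sym2 V}
    (he : e ∉ P) : AltCond (M \ {e}) P := by
  have h1 : P ∩ (M \ {e}) = P ∩ M := by
    ext f; simp only [Finset.mem_inter, Finset.mem_sdiff, Finset.mem_singleton]
    constructor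
    · tauto
    · rintro ⟨hp, hm⟩
      exact ⟨hp, hm, fun hf => he (hf ▸ hp)⟩
  have h2 : P \ (M \ {e}) = P \ M := by
    rw [← Finset.sdiff_inter_self_left, h1, Finset.sdiff_inter_self_left]
  unfold AltCond
  rw [h1, h2]
  exact h

/-- Every edge of `E` has exactly one endpoint in `S`. -/
def Splits (E : Finset (Sym2 V)) (S : Finset V) : Prop :=
  ∀ x y, s(x, y) ∈ E → (x ∈ S ↔ y ∉ S)

theorem splits_left {A B : Finset V} (hAB : Disjoint A B) {E : Finset (Sym2 V)}
    (hE : E ⊆ bipEdges A B) : Splits E A := by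
  intro x y h
  have hd : ∀ z, z ∈ A → z ∉ B := fun z hz => Finset.disjoint_left.1 hAB hz
  have := mk_mem_bipEdges.1 (hE h)
  have := hd x; have := hd y
  tauto

theorem splits_right {A B : Finset V} (hAB : Disjoint A B) {E : Finset (Sym2 V)}
    (hE : E ⊆ bipEdges A B) : Splits E B := by
  intro x y h
  have hd : ∀ z, z ∈ A → z ∉ B := fun z hz => Finset.disjoint_left.1 hAB hz
  have := mk_mem_bipEdges.1 (hE h)
  have := hd x; have := hd y
  tauto

theorem altCond_of_isChain {E M : Finset (Sym2 V)} {S : Finset V} (hS : Splits E S) :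
    ∀ {l : List V}, l.Nodup → l.IsChain (AltStep E M S) → AltCond M (pathEdges l).toFinset
  | [], _, _ => by simp [pathEdges, AltCond]
  | [_], _, _ => by simp [pathEdges, AltCond]
  | x :: y :: t, hn, hc => by
    rw [List.isChain_cons_cons] at hc
    rw [pathEdges_cons_cons, List.toFinset_cons]
    refine (altCond_of_isChain hS (List.nodup_cons.1 hn).2 hc.2).insert fun v hv f hf hvf => ?_
    rw [List.mem_toFinset] at hf
    rcases Sym2.mem_iff.1 hv with rfl | rfl
    · exact absurd (mem_of_mem_pathEdges hf hvf) (List.nodup_cons.1 hn).1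
    cases t with
    | nil => simp [pathEdges] at hf
    | cons z t =>
      rw [pathEdges_cons_cons, List.mem_cons] at hf
      rcases hf with rfl | hf
      · have h2 := (List.isChain_cons_cons.1 hc.2).1
        have := hS _ _ hc.1.1
        rw [hc.1.2, h2.2]
        tauto
      · exact absurd (mem_of_mem_pathEdges hf hvf)
          (List.nodup_cons.1 (List.nodup_cons.1 hn).2).1

/-- Along an alternating path in a bipartite graph, the direction in which matching edges are
traversed is determined by the first edge. -/
theorem isChain_of_altCond {E M : Finset (Sym2 V)} {S : Finset V} (hS : Splits E S) :
    ∀ {x y : V} {t : List V}, (x :: y :: t).Nodup →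
      AltCond M (pathEdges (x :: y :: t)).toFinset →
      (∀ e ∈ pathEdges (x :: y :: t), e ∈ E) →
      (x :: y :: t).IsChain fun u v =>
        s(u, v) ∈ E ∧ ((s(u, v) ∈ M ↔ u ∈ S) ↔ (s(x, y) ∈ M ↔ x ∈ S))
  | x, y, [], _, _, hE => by
    simpa using hE s(x, y) (by simp [pathEdges])
  | x, y, z :: t, hn, ha, hE => by
    have hsub : (pathEdges (y :: z :: t)).toFinset ⊆ (pathEdges (x :: y :: z :: t)).toFinset := by
      rw [pathEdges_cons_cons x, List.toFinset_cons]
      exact Finset.subset_insert _ _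
    have ih := isChain_of_altCond hS (List.nodup_cons.1 hn).2 (ha.mono hsub)
      fun e he => hE e (List.mem_cons_of_mem _ he)
    have hxy : s(x, y) ∈ (pathEdges (x :: y :: z :: t)).toFinset := by simp [pathEdges_cons_cons]
    have hyz : s(y, z) ∈ (pathEdges (x :: y :: z :: t)).toFinset := by simp [pathEdges_cons_cons]
    have hne : s(x, y) ≠ s(y, z) := fun h =>
      not_mem_pathEdges_of_nodup hn (by rw [h]; simp [pathEdges_cons_cons])
    have halt : ¬(s(x, y) ∈ M ↔ s(y, z) ∈ M) := by
      intro hiff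
      by_cases hm : s(x, y) ∈ M
      · exact hne (ha.1 y _ (Finset.mem_inter.2 ⟨hxy, hm⟩) _
          (Finset.mem_inter.2 ⟨hyz, hiff.1 hm⟩) (Sym2.mem_mk_right _ _) (Sym2.mem_mk_left _ _))
      · exact hne (ha.2 y _ (Finset.mem_sdiff.2 ⟨hxy, hm⟩) _
          (Finset.mem_sdiff.2 ⟨hyz, fun h => hm (hiff.2 h)⟩)
          (Sym2.mem_mk_right _ _) (Sym2.mem_mk_left _ _))
    have hb := hS x y (hE _ (List.mem_toFinset.1 hxy))
    have hc : (s(y, z) ∈ M ↔ y ∈ S) ↔ (s(x, y) ∈ M ↔ x ∈ S) := by tauto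
    rw [List.isChain_cons_cons]
    refine ⟨⟨hE _ (List.mem_toFinset.1 hxy), Iff.rfl⟩, ?_⟩
    simpa only [hc] using ih

theorem exists_rel_getLast {α : Type*} {R : α → α → Prop} {b : α} :
    ∀ {x y : α} {t : List α}, (x :: y :: t).IsChain R → (x :: y :: t).getLast? = some b →
      ∃ c, R c b
  | x, y, [], h, hb => by
    simp only [List.isChain_cons_cons] at h
    simp only [List.getLast?_cons_cons, List.getLast?_singleton, Option.some.injEq] at hb
    exact ⟨x, hb ▸ h.1⟩
  | _, _, _ :: _, h, hb =>
    exists_rel_getLast (List.isChain_cons_cons.1 h).2 (by rwa [List.getLast?_cons_cons] at hb)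

theorem reflTransGen_of_isChain {α : Type*} {R : α → α → Prop} {b : α} :
    ∀ {x : α} {t : List α}, (x :: t).IsChain R → (x :: t).getLast? = some b → ReflTransGen R x b
  | x, [], _, hb => by
    simp only [List.getLast?_singleton, Option.some.injEq] at hb
    exact hb ▸ .refl
  | _, _ :: _, h, hb =>
    .head (List.isChain_cons_cons.1 h).1
      (reflTransGen_of_isChain (List.isChain_cons_cons.1 h).2
        (by rwa [List.getLast?_cons_cons] at hb))

theorem exists_nodup_isChain {α : Type*} {R : α → α → Prop} {u v : α} (h : ReflTransGen R u v) :
    ∃ t, (u :: t).Nodup ∧ (u :: t).IsChain R ∧ (u :: t).getLast? = some v := by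
  induction h using ReflTransGen.head_induction_on with
  | refl => exact ⟨[], by simp⟩
  | @head a c hac _ ih =>
    obtain ⟨t, hn, hc, hl⟩ := ih
    by_cases ha : a ∈ c :: t
    · obtain ⟨p, q, hpq⟩ := List.append_of_mem ha
      rw [hpq] at hn hc hl
      refine ⟨q, (List.nodup_append.1 hn).2.1, hc.right_of_append, ?_⟩
      rwa [List.getLast?_append_of_ne_nil _ (by simp)] at hl
    · exact ⟨c :: t, List.nodup_cons.2 ⟨ha, hn⟩, List.isChain_cons_cons.2 ⟨hac, hc⟩,
        by rwa [List.getLast?_cons_cons]⟩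

theorem card_inter_of_isChain {E M : Finset (Sym2 V)} {S : Finset V} (hS : Splits E S) {b : V}
    (hb : b ∉ S) : ∀ {x : V} {t : List V}, (x :: t).Nodup → (x :: t).IsChain (AltStep E M S) →
      (x :: t).getLast? = some b →
      ((pathEdges (x :: t)).toFinset ∩ M).card =
        ((pathEdges (x :: t)).toFinset \ M).card + if x ∈ S then 1 else 0
  | x, [], _, _, hl => by
    simp only [List.getLast?_singleton, Option.some.injEq] at hl
    subst hl
    simp [pathEdges, hb]
  | x, y :: t, hn, hc, hl => by
    rw [List.isChain_cons_cons] at hc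
    rw [List.getLast?_cons_cons] at hl
    have ih := card_inter_of_isChain hS hb (List.nodup_cons.1 hn).2 hc.2 hl
    have hnot : s(x, y) ∉ (pathEdges (y :: t)).toFinset := by
      rw [List.mem_toFinset]
      exact not_mem_pathEdges_of_nodup hn
    have hxy := hS _ _ hc.1.1
    rw [pathEdges_cons_cons, List.toFinset_cons]
    by_cases hx : x ∈ S
    · have hm := hc.1.2.2 hx
      rw [Finset.insert_inter_of_mem hm, Finset.insert_sdiff_of_mem _ hm,
        Finset.card_insert_of_notMem (by simp [hnot, -List.mem_toFinset]), ih,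
        if_neg (hxy.1 hx), if_pos hx]
    · have hm : s(x, y) ∉ M := fun h => hx (hc.1.2.1 h)
      rw [Finset.insert_inter_of_notMem hm, Finset.insert_sdiff_of_notMem _ hm,
        Finset.card_insert_of_notMem (by simp [hnot, -List.mem_toFinset]), ih,
        if_neg hx, if_pos (by tauto)]

/-- A sequence of steps from `u` to `v ≠ u` contains an alternating path from `u` to `v`. -/
theorem exists_isAltPath_of_reflTransGen {E M : Finset (Sym2 V)} {S : Finset V}
    (hS : Splits E S) {u v : V} (huv : u ≠ v) (h : ReflTransGen (AltStep E M S) u v) :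
    ∃ P, IsAltPath E M P u v ∧ (u ∈ S → v ∉ S → (P \ M).card < (P ∩ M).card) := by
  obtain ⟨t, hn, hc, hl⟩ := exists_nodup_isChain h
  refine ⟨(pathEdges (u :: t)).toFinset, ⟨⟨u :: t, hn, ?_, rfl, hl,
    mem_of_mem_pathEdges_of_isChain hc, rfl⟩, altCond_of_isChain hS hn hc⟩, fun hu hv => ?_⟩
  · cases t with
    | nil => simp [huv] at hl
    | cons => simp
  · rw [card_inter_of_isChain hS hv hn hc hl, if_pos hu]
    exact Nat.lt_succ_self _

theorem IsAltPath.mono {E E' M P : Finset (Sym2 V)} {u v : V} (h : IsAltPath E M P u v)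
    (hP : P ⊆ E') : IsAltPath E' M P u v := by
  obtain ⟨⟨l, hn, hlen, hh, hl, -, rfl⟩, ha⟩ := h
  exact ⟨⟨l, hn, hlen, hh, hl, fun e he => hP (List.mem_toFinset.2 he), rfl⟩, ha⟩

theorem IsAltPath.subset {E M P : Finset (Sym2 V)} {u v : V} (h : IsAltPath E M P u v) :
    P ⊆ E := by
  obtain ⟨⟨l, -, -, -, -, hE, rfl⟩, -⟩ := h
  exact fun e he => hE e (List.mem_toFinset.1 he)

/-- The steps of an alternating path, in terms of its first edge `{u, y}`. -/
theorem IsAltPath.exists_list {E M P : Finset (Sym2 V)} {u v : V} (h : IsAltPath E M P u v)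
    {S : Finset V} (hS : Splits E S) :
    ∃ y t, (u :: y :: t).Nodup ∧ (u :: y :: t).getLast? = some v ∧
      P = (pathEdges (u :: y :: t)).toFinset ∧
      (u :: y :: t).IsChain fun p q =>
        s(p, q) ∈ E ∧ ((s(p, q) ∈ M ↔ p ∈ S) ↔ (s(u, y) ∈ M ↔ u ∈ S)) := by
  obtain ⟨⟨l, hn, hlen, hh, hl, hE, rfl⟩, ha⟩ := h
  match l, hlen, hh with
  | x :: y :: t, _, hh =>
    simp only [List.head?_cons, Option.some.injEq] at hh
    subst hh
    exact ⟨y, t, hn, hl, rfl, isChain_of_altCond hS hn ha hE⟩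

/-- An alternating path ending at `v ∈ S` by an unmatched edge traverses matching edges exactly
when it leaves `S`. -/
theorem IsAltPath.reflTransGen {E M P : Finset (Sym2 V)} {u v : V} (h : IsAltPath E M P u v)
    {S : Finset V} (hS : Splits E S) (hv : v ∈ S) (hfree : ∀ c, s(c, v) ∈ E → s(c, v) ∉ M) :
    ReflTransGen (AltStep E M S) u v := by
  obtain ⟨y, t, -, hl, -, hc⟩ := h.exists_list hS
  obtain ⟨c, hcE, hcM⟩ := exists_rel_getLast hc hl
  have h1 := hS _ _ hcE
  have h2 := hfree c hcE
  have h3 : s(u, y) ∈ M ↔ u ∈ S := by tauto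
  refine reflTransGen_of_isChain (hc.imp fun p q hpq => ⟨hpq.1, hpq.2.2 h3⟩) hl

theorem last_edge_not_mem {E M : Finset (Sym2 V)} {S : Finset V} (hS : Splits E S) {a b : V}
    (hb : b ∈ S) (hab : s(a, b) ∈ M) :
    ∀ {x : V} {t : List V}, (x :: t).Nodup → (x :: t).IsChain (AltStep E M S) →
      (x :: t).getLast? = some b → s(a, b) ∉ pathEdges (x :: t)
  | _, [], _, _, _ => by simp [pathEdges]
  | x, y :: t, hn, hc, hl => by
    rw [List.isChain_cons_cons] at hc
    rw [List.getLast?_cons_cons] at hl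
    rw [pathEdges_cons_cons, List.mem_cons, not_or]
    refine ⟨fun he => ?_, last_edge_not_mem hS hb hab (List.nodup_cons.1 hn).2 hc.2 hl⟩
    have hx : x ≠ b := by
      rintro rfl
      exact (List.nodup_cons.1 hn).1 (List.mem_of_getLast? hl)
    rcases Sym2.eq_iff.1 he with ⟨-, rfl⟩ | ⟨-, rfl⟩
    · have := hS _ _ hc.1.1
      have := hc.1.2.1 (he ▸ hab)
      tauto
    · exact hx rfl

end AlternatingPaths

section Clusters

open Relation

variable {V : Type*} [DecidableEq V]

theorem phi_subset {E M : Finset (Sym2 V)} {w : Sym2 V → ℝ} (h : M ⊆ E) : phi E w M ⊆ E := by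
  intro e he
  simp only [phi, Finset.mem_union, Finset.mem_filter] at he
  exact he.elim (fun hm => h hm) And.left

theorem mem_phi_of_lt {E M : Finset (Sym2 V)} {w : Sym2 V → ℝ} {e f : Sym2 V}
    (he : IsMaxEdge w M e) (hf : f ∈ E) (hlt : w f < w e) : f ∈ phi E w M := by
  simp only [phi, Finset.mem_union, Finset.mem_filter]
  exact Or.inr ⟨hf, e, he, hlt⟩

theorem isFree_sdiff_of_mem {E M : Finset (Sym2 V)} (hM : IsMatching E M) {e : Sym2 V}
    (he : e ∈ M) {v : V} (hv : v ∈ e) : IsFree (M \ {e}) v := by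
  intro f hf hvf
  rw [Finset.mem_sdiff, Finset.mem_singleton] at hf
  exact hf.2 (hM.2 v f hf.1 e he hvf hv)

/-- In a bottleneck cluster with a critical bottleneck edge, every agent is matched. -/
theorem IsBotCluster.exists_mate {A B : Finset V} {w : Sym2 V → ℝ} {M : Finset (Sym2 V)}
    {a b : V} (hAB : Disjoint A B) (hM : IsMatching (bipEdges A B) M) (hb : b ∈ B)
    (hcrit : IsCritBotEdge (bipEdges A B) w M s(a, b)) (hclus : IsBotCluster A B w M b)
    {f : V} (hf : f ∈ A) : ∃ c ∈ B, s(f, c) ∈ M := by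
  by_contra! hno
  have hdisj : ∀ z, z ∈ A → z ∉ B := fun z hz => Finset.disjoint_left.1 hAB hz
  have hfree : ∀ c, s(f, c) ∉ M := fun c hc => by
    rcases mk_mem_bipEdges.1 (hM.1 hc) with h | h
    · exact hno c h.2 hc
    · exact hdisj f hf h.2
  have hfb : f ≠ b := fun h => hdisj f hf (h ▸ hb)
  obtain ⟨P, hP⟩ := hclus f (Finset.mem_union_left _ hf) hfb
  have hS : Splits (phi (bipEdges A B) w M) B := splits_right hAB (phi_subset hM.1)
  obtain ⟨y, t, hn, hl, hPe, hc⟩ := hP.exists_list hS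
  have hfirst : s(f, y) ∈ M ↔ f ∈ B := iff_of_false (hfree y) (hdisj f hf)
  have he : s(a, b) ∉ P := by
    rw [hPe, List.mem_toFinset]
    exact last_edge_not_mem hS hb hcrit.1.1 hn (hc.imp fun p q h => ⟨h.1, h.2.2 hfirst⟩) hl
  refine hcrit.2 ⟨P, f, b, ⟨(hP.mono ?_).1, hP.2.sdiff_singleton he⟩, ?_, ?_⟩
  · exact fun e hePm => Finset.mem_sdiff.2
      ⟨hP.subset hePm, fun h => he (Finset.mem_singleton.1 h ▸ hePm)⟩
  · intro e heM hfe
    obtain ⟨c, rfl⟩ := Sym2.mem_iff_exists.1 hfe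
    exact hfree c (Finset.mem_sdiff.1 heM).1
  · exact isFree_sdiff_of_mem hM hcrit.1.1 (Sym2.mem_mk_right a b)

theorem mem_Vnu_iff {A B : Finset V} {w : Sym2 V → ℝ} {M : Finset (Sym2 V)} {a b : V}
    (hAB : Disjoint A B) (hM : IsMatching (bipEdges A B) M) (hb : b ∈ B) (hab : s(a, b) ∈ M)
    {v : V} : v ∈ Vnu A B w M a b ↔ v ∈ A ∪ B ∧
      ReflTransGen (AltStep (phi (bipEdges A B) w M \ {s(a, b)}) M B) v b := by
  have hS : Splits (phi (bipEdges A B) w M \ {s(a, b)}) B :=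
    splits_right hAB (Finset.sdiff_subset.trans (phi_subset hM.1))
  unfold Vnu
  rw [Set.mem_insert_iff, Set.mem_ofPred_eq]
  constructor
  · rintro (rfl | ⟨hv, P, hP⟩)
    · exact ⟨Finset.mem_union_right _ hb, .refl⟩
    · refine ⟨hv, hP.reflTransGen hS hb fun c hcE hcM => ?_⟩
      rw [Finset.mem_sdiff, Finset.mem_singleton] at hcE
      exact hcE.2 (by rw [hM.eq_left hcM hab])
  · rintro ⟨hv, h⟩
    by_cases hvb : v = b
    · exact Or.inl hvb
    · obtain ⟨P, hP, -⟩ := exists_isAltPath_of_reflTransGen hS hvb h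
      exact Or.inr ⟨hv, P, hP⟩

/-- Tasks of `Vnu` only have light edges to agents of `Vnu`. -/
theorem mem_Vnu_of_light {A B : Finset V} {w : Sym2 V → ℝ} {M : Finset (Sym2 V)} {a b : V}
    (hAB : Disjoint A B) (hM : IsMatching (bipEdges A B) M) (hb : b ∈ B)
    (hmax : IsMaxEdge w M s(a, b)) {c d : V} (hc : c ∈ A) (hd : d ∈ B)
    (hdV : d ∈ Vnu A B w M a b) (hlt : w s(c, d) < w s(a, b)) : c ∈ Vnu A B w M a b := by
  rw [mem_Vnu_iff hAB hM hb hmax.1] at hdV ⊢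
  refine ⟨Finset.mem_union_left _ hc, ?_⟩
  have hne : s(c, d) ≠ s(a, b) := fun h => (h ▸ hlt).false
  by_cases hcd : s(c, d) ∈ M
  · rcases hdV.2.cases_head with rfl | ⟨c', ⟨-, hstep⟩, hrest⟩
    · exact absurd (by rw [hM.eq_left hcd hmax.1]) hne
    · have h := hstep.2 hd
      rw [Sym2.eq_swap] at h
      rwa [hM.eq_left hcd h]
  · refine .head ⟨Finset.mem_sdiff.2 ⟨mem_phi_of_lt hmax (mk_mem_bipEdges.2 (Or.inl ⟨hc, hd⟩)) hlt,
      by simpa using hne⟩, iff_of_false hcd (Finset.disjoint_left.1 hAB hc)⟩ hdV.2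

/-- Agents of `Vnu` are matched with tasks of `Vnu` other than `b`. -/
theorem exists_mate_mem_Vnu {A B : Finset V} {w : Sym2 V → ℝ} {M : Finset (Sym2 V)} {a b : V}
    (hAB : Disjoint A B) (hM : IsMatching (bipEdges A B) M) (hb : b ∈ B)
    (hcrit : IsCritBotEdge (bipEdges A B) w M s(a, b)) {c : V} (hc : c ∈ A)
    (hcV : c ∈ Vnu A B w M a b) :
    ∃ d ∈ B, d ≠ b ∧ d ∈ Vnu A B w M a b ∧ s(c, d) ∈ M := by
  have hab := hcrit.1.1
  have hcb : c ≠ b := fun h => Finset.disjoint_left.1 hAB hc (h ▸ hb)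
  obtain ⟨f, hfM, hcf⟩ : ∃ f ∈ M \ {s(a, b)}, c ∈ f := by
    by_contra! hno
    rcases hcV with h | ⟨-, P, hP⟩
    · exact hcb h
    · have he : s(a, b) ∉ P := fun h => by simpa using hP.subset h
      exact hcrit.2 ⟨P, c, b, ⟨hP.1, hP.2.sdiff_singleton he⟩, hno,
        isFree_sdiff_of_mem hM hab (Sym2.mem_mk_right a b)⟩
  obtain ⟨d, rfl⟩ := Sym2.mem_iff_exists.1 hcf
  rw [Finset.mem_sdiff, Finset.mem_singleton] at hfM
  have hd : d ∈ B := by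
    rcases mk_mem_bipEdges.1 (hM.1 hfM.1) with h | h
    · exact h.2
    · exact absurd h.2 (Finset.disjoint_left.1 hAB hc)
  refine ⟨d, hd, ?_, ?_, hfM.1⟩
  · rintro rfl
    exact hfM.2 (by rw [hM.eq_left hfM.1 hab])
  · rw [mem_Vnu_iff hAB hM hb hab] at hcV ⊢
    have hswap : s(d, c) = s(c, d) := Sym2.eq_swap
    refine ⟨Finset.mem_union_right _ hd, .head ⟨?_, ?_⟩ hcV.2⟩
    · rw [hswap, Finset.mem_sdiff, Finset.mem_singleton]
      exact ⟨Finset.mem_union_left _ hfM.1, hfM.2⟩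
    · rw [hswap]
      exact iff_of_true hfM.1 hd

end Clusters

/-- **Corollary 3.** Under the hypotheses of Theorem 2, if there do NOT exist an agent
`i ∈ A2` and a task `j ∈ B2` simultaneously satisfying conditions (i), (ii) and (iii),
then `M1 ∪ M2` is an optimal MCM for `BOT(G3)`. -/
theorem merge_optimal_of_not_conditions {V : Type*} [DecidableEq V]
    (A1 A2 B1 B2 : Finset V)
    (hA1A2 : Disjoint A1 A2) (hA1B1 : Disjoint A1 B1) (hA1B2 : Disjoint A1 B2)
    (hA2B1 : Disjoint A2 B1) (hA2B2 : Disjoint A2 B2) (hB1B2 : Disjoint B1 B2)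
    (hB1 : 1 ≤ B1.card) (hA1 : B1.card ≤ A1.card)
    (hB2 : 1 ≤ B2.card) (hA2 : B2.card ≤ A2.card)
    (w : Sym2 V → ℝ) (M1 M2 : Finset (Sym2 V))
    (a1 b1 a2 b2 : V) (ha1 : a1 ∈ A1) (hb1 : b1 ∈ B1) (ha2 : a2 ∈ A2) (hb2 : b2 ∈ B2)
    (hM1 : IsOptMCM (bipEdges A1 B1) w M1) (he1M : s(a1, b1) ∈ M1)
    (hcrit1 : IsCritBotEdge (bipEdges A1 B1) w M1 s(a1, b1))
    (huniq : ∀ e, IsMaxEdge w M1 e → e = s(a1, b1))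
    (hclus1 : IsBotCluster A1 B1 w M1 b1)
    (hM2 : IsOptMCM (bipEdges A2 B2) w M2) (he2M : s(a2, b2) ∈ M2)
    (hcrit2 : IsCritBotEdge (bipEdges A2 B2) w M2 s(a2, b2))
    (hclus2 : IsBotCluster A2 B2 w M2 b2)
    (hw12 : w s(a2, b2) < w s(a1, b1))
    (hnot : ¬ ∃ i ∈ A2, ∃ j ∈ B2,
      (∃ b', b' ∈ Vnu A1 B1 w M1 a1 b1 ∧ b' ∈ B1 ∧ w s(i, b') < w s(a1, b1)) ∧
      (∃ a', a' ∈ Vmu A1 B1 w M1 a1 b1 ∧ a' ∈ A1 ∧ w s(j, a') < w s(a1, b1)) ∧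
      (∃ P, IsAltPath (bipEdges (A1 ∪ A2) (B1 ∪ B2)) M2 P i j ∧
        (∀ e ∈ P, w e < w s(a1, b1)) ∧ (P \ M2).card < (P ∩ M2).card)) :
    IsOptMCM (bipEdges (A1 ∪ A2) (B1 ∪ B2)) w (M1 ∪ M2) := by
  classical
  have hd3 : Disjoint (A1 ∪ A2) (B1 ∪ B2) := by
    simp only [Finset.disjoint_union_left, Finset.disjoint_union_right]
    exact ⟨⟨hA1B1, hA2B1⟩, hA1B2, hA2B2⟩
  have hd12 : Disjoint (A1 ∪ B1) (A2 ∪ B2) := by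
    simp only [Finset.disjoint_union_left, Finset.disjoint_union_right]
    exact ⟨⟨hA1A2, hA2B1.symm⟩, hA1B2, hB1B2⟩
  have hm1 := hM1.1.1
  have hm2 := hM2.1.1
  obtain ⟨hm3, hdM⟩ := hm1.union hm2 hd12
  have hcard3 : (M1 ∪ M2).card = (B1 ∪ B2).card := by
    rw [Finset.card_union_of_disjoint hdM, Finset.card_union_of_disjoint hB1B2,
      hM1.1.card_eq hA1B1 hA1, hM2.1.card_eq hA2B2 hA2]
  have hmcm3 : IsMCM (bipEdges (A1 ∪ A2) (B1 ∪ B2)) (M1 ∪ M2) :=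
    ⟨hm3, fun M' hM' => hcard3 ▸ hM'.card_le⟩
  refine ⟨hmcm3, fun M' e e' hM' he he' => ?_⟩
  have hlight2 : ∀ f ∈ M2, w f < w s(a1, b1) := fun f hf => (hcrit2.1.2 f hf).trans_lt hw12
  have hle : w e ≤ w s(a1, b1) := by
    rcases Finset.mem_union.1 he.1 with h | h
    · exact hcrit1.1.2 e h
    · exact (hlight2 e h).le
  refine hle.trans (le_of_not_gt fun hlt => ?_)
  have hlight : ∀ f ∈ M', w f < w s(a1, b1) := fun f hf => (he'.2 f hf).trans_lt hlt
  set E2 := (bipEdges A2 B2).filter fun f => w f < w s(a1, b1) with hE2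
  have hE2sub : E2 ⊆ bipEdges A2 B2 := Finset.filter_subset _ _
  have hS2 : Splits E2 A2 := splits_left hA2B2 hE2sub
  have hd2 : ∀ {z}, z ∈ A2 → z ∉ B2 := fun {_} h => Finset.disjoint_left.1 hA2B2 h
  -- vertices of `G2` reachable from `Vnu` through a light edge into `A2`
  let reach : V → Prop := fun v => ∃ i ∈ A2,
    (∃ b', b' ∈ Vnu A1 B1 w M1 a1 b1 ∧ b' ∈ B1 ∧ w s(i, b') < w s(a1, b1)) ∧
    Relation.ReflTransGen (AltStep E2 M2 A2) i v
  let RA := (A1.filter fun v => v ∈ Vnu A1 B1 w M1 a1 b1) ∪ A2.filter reach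
  let RB := (B1.filter fun v => v ∈ Vnu A1 B1 w M1 a1 b1) ∪ B2.filter reach
  have hRA : ∀ {v}, v ∈ RA ↔ (v ∈ A1 ∧ v ∈ Vnu A1 B1 w M1 a1 b1) ∨ (v ∈ A2 ∧ reach v) := by
    simp [RA]
  have hRB : ∀ {v}, v ∈ RB ↔ (v ∈ B1 ∧ v ∈ Vnu A1 B1 w M1 a1 b1) ∨ (v ∈ B2 ∧ reach v) := by
    simp [RB]
  have hb1RB : b1 ∈ RB := hRB.2 (Or.inl ⟨hb1, Or.inl rfl⟩)
  have hlt_card : RA.card ≤ (RB.erase b1).card := by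
    refine Finset.card_le_card_of_forall_subsingleton (fun a b => s(a, b) ∈ M1 ∪ M2) ?_ ?_
    · intro c hc
      rcases hRA.1 hc with ⟨hcA, hcV⟩ | ⟨hcA, i, hi, hib, hic⟩
      · obtain ⟨d, hd, hdb, hdV, hcd⟩ := exists_mate_mem_Vnu hA1B1 hm1 hb1 hcrit1 hcA hcV
        exact ⟨d, Finset.mem_erase.2 ⟨hdb, hRB.2 (Or.inl ⟨hd, hdV⟩)⟩,
          Finset.mem_union_left _ hcd⟩
      · obtain ⟨d, hd, hcd⟩ := hclus2.exists_mate hA2B2 hm2 hb2 hcrit2 hcA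
        refine ⟨d, Finset.mem_erase.2 ⟨?_, hRB.2 (Or.inr ⟨hd, i, hi, hib, hic.tail ?_⟩)⟩,
          Finset.mem_union_right _ hcd⟩
        · rintro rfl
          exact Finset.disjoint_left.1 hB1B2 hb1 hd
        · exact ⟨Finset.mem_filter.2 ⟨hm2.1 hcd, hlight2 _ hcd⟩, iff_of_true hcd hcA⟩
    · rintro d - c ⟨-, hc⟩ c' ⟨-, hc'⟩
      exact hm3.eq_left hc hc'
  have hle_card : RB.card ≤ RA.card := by
    refine Finset.card_le_card_of_forall_subsingleton (fun b a => s(a, b) ∈ M') ?_ ?_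
    · intro d hd
      have hdB : d ∈ B1 ∪ B2 := by
        rcases hRB.1 hd with h | h
        · exact Finset.mem_union_left _ h.1
        · exact Finset.mem_union_right _ h.1
      obtain ⟨c, hcA, hcd⟩ := hM'.1.exists_mate (hcard3 ▸ hM'.2 _ hm3) hdB
      refine ⟨c, hRA.2 ?_, hcd⟩
      have hw := hlight _ hcd
      rcases hRB.1 hd with ⟨hdB1, hdV⟩ | ⟨hdB2, i, hi, hib, hid⟩ <;>
        rcases Finset.mem_union.1 hcA with hc | hc
      · exact Or.inl ⟨hc, mem_Vnu_of_light hA1B1 hm1 hb1 hcrit1.1 hc hdB1 hdV hw⟩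
      · exact Or.inr ⟨hc, c, hc, ⟨d, hdV, hdB1, hw⟩, .refl⟩
      · refine Or.inl ⟨hc, ?_⟩
        by_contra hcV
        have hidne : i ≠ d := fun h => hd2 hi (h ▸ hdB2)
        obtain ⟨P, hP, hPcard⟩ := exists_isAltPath_of_reflTransGen hS2 hidne hid
        refine hnot ⟨i, hi, d, hdB2, hib, ⟨c, ⟨?_, hcV⟩, hc, by rwa [Sym2.eq_swap]⟩, P,
          hP.mono ?_, ?_, hPcard hi fun h => hd2 h hdB2⟩
        · exact Finset.mem_coe.2 (Finset.mem_union_left _ hc)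
        · exact (hP.subset.trans hE2sub).trans
            (bipEdges_mono Finset.subset_union_right Finset.subset_union_right)
        · exact fun f hf => (Finset.mem_filter.1 (hP.subset hf)).2
      · refine Or.inr ⟨hc, i, hi, hib, ?_⟩
        by_cases hcd2 : s(c, d) ∈ M2
        · rcases hid.cases_tail with rfl | ⟨c', hic', hstep⟩
          · exact absurd hdB2 (hd2 hi)
          · have hc' : c' ∈ A2 := (hS2 _ _ hstep.1).2 fun h => hd2 h hdB2
            rwa [hm2.eq_left hcd2 (hstep.2.2 hc')]
        · refine hid.tail ?_
          have hswap : s(d, c) = s(c, d) := Sym2.eq_swap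
          refine ⟨?_, ?_⟩
          · rw [hswap]
            exact Finset.mem_filter.2 ⟨mk_mem_bipEdges.2 (Or.inl ⟨hc, hdB2⟩), hw⟩
          · rw [hswap]
            exact iff_of_false hcd2 fun h => hd2 h hdB2
    · rintro c - d ⟨-, hd⟩ d' ⟨-, hd'⟩
      exact hM'.1.eq_right hd hd'
  have := Finset.card_erase_lt_of_mem hb1RB
  omega
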